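/- Let M be a non-neighbourly 3-pseudomanifold with exactly 8 vertices in which every vertex has degree at least 6, and let u be a vertex of M of degree 6. Then there exists a bistellar 1-move κ_τ : M ↦ N such that the degree of u in N is 7. -/

import Mathlib

/-! Basic framework for finite simplicial complexes, pseudomanifolds and
bistellar moves, following Datta–Nilakantan. A complex is recorded as the
finite set of its faces (nonempty finite subsets of the vertex type). -/

namespace NPM

variable {α β : Type*} [DecidableEq α] [DecidableEq β]

/-- A "complex" datum: a finite family of finite subsets of `α`. -/
abbrev Complex (α : Type*) := Finset (Finset α)

/-- `K` is a simplicial complex: a nonempty collection of nonempty sets,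
closed under passing to nonempty subsets. -/
def IsComplex (K : Complex α) : Prop :=
  K.Nonempty ∧ (∀ σ ∈ K, σ.Nonempty) ∧ ∀ σ ∈ K, ∀ τ ⊆ σ, τ.Nonempty → τ ∈ K

/-- The vertex set of `K`. -/
def verts (K : Complex α) : Finset α := K.sup id

/-- `K` is pure of dimension `d`: every face is contained in a face with
`d+1` vertices. -/
def IsPure (K : Complex α) (d : ℕ) : Prop :=
  ∀ σ ∈ K, ∃ τ ∈ K, σ ⊆ τ ∧ τ.card = d + 1

/-- The facets ("`d`-faces") of a pure `d`-dimensional complex. -/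
def facets (K : Complex α) (d : ℕ) : Complex α := K.filter (fun σ => σ.card = d + 1)

/-- The link of a face `σ` in `K`. -/
def link (K : Complex α) (σ : Finset α) : Complex α :=
  K.filter (fun τ => Disjoint τ σ ∧ σ ∪ τ ∈ K)

/-- The degree of a face: the number of vertices of its link. -/
def degree (K : Complex α) (σ : Finset α) : ℕ := (verts (link K σ)).card

/-- A weak `d`-pseudomanifold: a pure `d`-dimensional complex in which every
`(d-1)`-face (i.e. face with `d` vertices) lies in exactly two facets. -/
def WeakPM (K : Complex α) (d : ℕ) : Prop :=
  IsComplex K ∧ IsPure K d ∧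
    ∀ σ ∈ K, σ.card = d → (K.filter fun τ => σ ⊆ τ ∧ τ.card = d + 1).card = 2

/-- Strong connectedness: any two facets are joined by a chain of facets in
which consecutive facets meet in a `(d-1)`-face. -/
def SConn (K : Complex α) (d : ℕ) : Prop :=
  ∀ σ ∈ facets K d, ∀ τ ∈ facets K d,
    Relation.ReflTransGen
      (fun a b => a ∈ facets K d ∧ b ∈ facets K d ∧ (a ∩ b).card = d) σ τ

/-- A `d`-pseudomanifold: a strongly connected weak `d`-pseudomanifold. -/
def IsPM (K : Complex α) (d : ℕ) : Prop := WeakPM K d ∧ SConn K d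

/-- Connectedness of a complex: the graph of vertices and edges is connected. -/
def Conn (K : Complex α) : Prop :=
  (verts K).Nonempty ∧ ∀ u ∈ verts K, ∀ v ∈ verts K,
    Relation.ReflTransGen (fun a b => a ≠ b ∧ ({a, b} : Finset α) ∈ K) u v

/-- A normal `d`-pseudomanifold: a connected weak `d`-pseudomanifold in which
the link of every face of dimension `≤ d - 2` is connected. -/
def NormalPM (K : Complex α) (d : ℕ) : Prop :=
  WeakPM K d ∧ Conn K ∧ ∀ σ ∈ K, σ.card + 1 ≤ d → Conn (link K σ)

/-- `K` is neighbourly: every pair of vertices forms an edge. -/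
def Neighbourly (K : Complex α) : Prop :=
  ∀ u ∈ verts K, ∀ v ∈ verts K, u ≠ v → ({u, v} : Finset α) ∈ K

/-- Isomorphism of complexes: a map injective on the vertex set carrying the
faces of `K` exactly onto the faces of `L`. -/
def Iso (K : Complex α) (L : Complex β) : Prop :=
  ∃ f : α → β, Set.InjOn f ↑(verts K) ∧ L = K.image (fun σ => σ.image f)

/-- The complex generated by a family of facets: all nonempty subsets. -/
def genCx (F : Finset (Finset α)) : Complex α :=
  F.biUnion fun σ => σ.powerset.filter (fun τ => τ.Nonempty)

/-- The standard sphere on the vertex set `B`: all nonempty proper subsets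
of `B`. -/
def stdSphere (B : Finset α) : Complex α :=
  B.powerset.filter fun τ => τ.Nonempty ∧ τ ≠ B

/-- In a weak `d`-pseudomanifold, a removable `(d-i)`-face `A`: its link is a
standard sphere `S^{i-1}_{i+1}(B)` with `B` not a face.  (For `d = 3`,
`i = 1` gives removable 2-faces and `i = 2` gives removable 1-faces.) -/
def RemovableFace (d i : ℕ) (K : Complex α) (A : Finset α) : Prop :=
  A ∈ K ∧ A.card = d - i + 1 ∧
    ∃ B : Finset α, B.card = i + 1 ∧ B ∉ K ∧ link K A = stdSphere B

/-- The bistellar `i`-move (`0 < i ≤ d`) relation on weak `d`-pseudomanifolds: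
`L` is obtained from `K` by removing a removable `(d-i)`-face `A` with
`link K A = stdSphere B` and inserting the facets `(B ∪ A) \ {v}`, `v ∈ A`. -/
def BMove (d i : ℕ) (K L : Complex α) : Prop :=
  ∃ A B : Finset α, A ∈ K ∧ A.card = d - i + 1 ∧ B.card = i + 1 ∧ B ∉ K ∧
    link K A = stdSphere B ∧
    L = genCx ((facets K d).filter (fun σ => ¬ A ⊆ σ) ∪
          A.image fun v => (B ∪ A).erase v)

/-- The bistellar `0`-move: star a new vertex `w` in a facet `σ`. -/
def BMove0 (d : ℕ) (K L : Complex α) : Prop :=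
  ∃ σ w, σ ∈ K ∧ σ.card = d + 1 ∧ w ∉ verts K ∧
    L = genCx (((facets K d).erase σ) ∪ σ.image fun v => insert w (σ.erase v))

/-- A single bistellar move of any type `0 ≤ i ≤ d`. -/
def BStep (d : ℕ) (K L : Complex α) : Prop :=
  BMove0 d K L ∨ ∃ i, 0 < i ∧ i ≤ d ∧ BMove d i K L

/-- Bistellar equivalence: a finite sequence of bistellar moves. -/
def BEquiv (d : ℕ) : Complex α → Complex α → Prop :=
  Relation.ReflTransGen (BStep d)

/-- A proper bistellar move: a bistellar `i`-move with `0 < i < d`. -/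
def PMove (d : ℕ) (K L : Complex α) : Prop := ∃ i, 0 < i ∧ i < d ∧ BMove d i K L

/-- Proper bistellar equivalence. -/
def PEquiv (d : ℕ) : Complex α → Complex α → Prop :=
  Relation.ReflTransGen (PMove d)

/-- The result of the bistellar move on the face `A` of the weak
`d`-pseudomanifold `K` (deterministic form: `B` is the vertex set of
`link K A`). -/
def kappa (d : ℕ) (K : Complex α) (A : Finset α) : Complex α :=
  genCx ((facets K d).filter (fun σ => ¬ A ⊆ σ) ∪
    A.image fun v => (verts (link K A) ∪ A).erase v)

/-- A cycle: a (finite) 1-pseudomanifold. -/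
def Cycle (K : Complex α) : Prop := IsPM K 1

/-- A combinatorial 2-manifold: a weak 2-pseudomanifold all whose vertex
links are cycles. -/
def Comb2Mfd (K : Complex α) : Prop :=
  WeakPM K 2 ∧ ∀ v, ({v} : Finset α) ∈ K → Cycle (link K {v})

/-- The Euler characteristic `f₀ - f₁ + f₂` of a 2-dimensional complex. -/
def eulerChar (K : Complex α) : ℤ :=
  ((K.filter fun σ => σ.card = 1).card : ℤ) -
    ((K.filter fun σ => σ.card = 2).card : ℤ) +
    ((K.filter fun σ => σ.card = 3).card : ℤ)

/-- A combinatorial 2-sphere: a connected combinatorial 2-manifold with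
Euler characteristic 2. -/
def Comb2Sphere (K : Complex α) : Prop := Comb2Mfd K ∧ Conn K ∧ eulerChar K = 2

/-- A combinatorial 3-manifold: a 3-pseudomanifold all whose vertex links are
combinatorial 2-spheres. -/
def Comb3Mfd (K : Complex α) : Prop :=
  IsPM K 3 ∧ ∀ v, ({v} : Finset α) ∈ K → Comb2Sphere (link K {v})

end NPM

namespace NPM

open Finset

/-- The sum of `s (2 - s)` over the triples of a six-element set is at most `12`, where `s` counts
the members of a family of four-element sets that contain the given triple. -/
lemma sum_triples_le_twelve (P : Finset (Fin 6) → ℤ) (hP : ∀ q, P q = 0 ∨ P q = 1) :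
    ∑ t ∈ powersetCard 3 (univ : Finset (Fin 6)),
      (∑ i ∈ tᶜ, P (insert i t)) * (2 - ∑ i ∈ tᶜ, P (insert i t)) ≤ 12 := by
  obtain ⟨g, hg⟩ : ∃ g : Fin 6 → Fin 6 → ℤ, ∀ i j, g i j = P ({i, j} : Finset (Fin 6))ᶜ :=
    ⟨_, fun _ _ => rfl⟩
  have hsq : ∀ i j, g i j * g i j = g i j := fun i j => by
    rcases hP ({i, j} : Finset (Fin 6))ᶜ with h | h <;> rw [hg, h] <;> rfl
  have hd : ∀ d : ℤ, 0 ≤ 2 - d * (3 - d) := fun d => by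
    rcases le_or_gt d 1 with h | h <;> nlinarith
  have hterm : ∀ a b c : Fin 6, a ≠ b → a ≠ c → b ≠ c →
      ∑ i ∈ ((({a, b, c} : Finset (Fin 6))ᶜ)ᶜ), P (insert i (({a, b, c} : Finset (Fin 6))ᶜ))
        = g b c + g a c + g a b := by
    intro a b c hab hac hbc
    have h1 : insert a (({a, b, c} : Finset (Fin 6))ᶜ) = ({b, c} : Finset (Fin 6))ᶜ := by
      ext x; simp only [mem_insert, mem_compl, mem_singleton]; grind
    have h2 : insert b (({a, b, c} : Finset (Fin 6))ᶜ) = ({a, c} : Finset (Fin 6))ᶜ := by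
      ext x; simp only [mem_insert, mem_compl, mem_singleton]; grind
    have h3 : insert c (({a, b, c} : Finset (Fin 6))ᶜ) = ({a, b} : Finset (Fin 6))ᶜ := by
      ext x; simp only [mem_insert, mem_compl, mem_singleton]; grind
    rw [compl_compl, sum_insert (by simp [hab, hac]), sum_insert (by simp [hbc]), sum_singleton,
      h1, h2, h3, ← hg, ← hg, ← hg, add_assoc]
  have hset : powersetCard 3 (univ : Finset (Fin 6)) =
      ({{0, 1, 2}, {0, 1, 3}, {0, 1, 4}, {0, 1, 5}, {0, 2, 3}, {0, 2, 4}, {0, 2, 5}, {0, 3, 4},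
        {0, 3, 5}, {0, 4, 5}, {1, 2, 3}, {1, 2, 4}, {1, 2, 5}, {1, 3, 4}, {1, 3, 5}, {1, 4, 5},
        {2, 3, 4}, {2, 3, 5}, {2, 4, 5}, {3, 4, 5}} :
        Finset (Finset (Fin 6))).image compl := by decide +kernel
  rw [hset, sum_image compl_injective.injOn]
  repeat rw [sum_insert (by decide)]
  rw [sum_singleton, hterm, hterm, hterm, hterm, hterm, hterm, hterm, hterm, hterm, hterm,
    hterm, hterm, hterm, hterm, hterm, hterm, hterm, hterm, hterm, hterm] <;> try decide
  linarith only [hd (g 0 1 + g 0 2 + g 0 3 + g 0 4 + g 0 5),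
    hd (g 0 1 + g 1 2 + g 1 3 + g 1 4 + g 1 5),
    hd (g 0 2 + g 1 2 + g 2 3 + g 2 4 + g 2 5), hd (g 0 3 + g 1 3 + g 2 3 + g 3 4 + g 3 5),
    hd (g 0 4 + g 1 4 + g 2 4 + g 3 4 + g 4 5), hd (g 0 5 + g 1 5 + g 2 5 + g 3 5 + g 4 5),
    hsq 0 1, hsq 0 2, hsq 0 3, hsq 0 4, hsq 0 5, hsq 1 2, hsq 1 3, hsq 1 4, hsq 1 5,
    hsq 2 3, hsq 2 4, hsq 2 5, hsq 3 4, hsq 3 5, hsq 4 5]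

lemma card_le_of_isPure {α : Type*} {K : Complex α} {d : ℕ} (hp : IsPure K d) {σ : Finset α} (h : σ ∈ K) :
    #σ ≤ d + 1 := by
  obtain ⟨τ, -, hτ, hc⟩ := hp σ h
  exact hc ▸ card_le_card hτ

lemma ne_of_mem_notMem {α : Type*} {s t : Finset α} (z : α) (hs : z ∈ s) (ht : z ∉ t) : s ≠ t :=
  fun h => ht (h ▸ hs)

variable {α : Type*} [DecidableEq α]

/-- Crossing the edge `{a, b}` of the triangle `{x, a, b}`. -/
lemma exists_flip {T : Finset (Finset α)}
    (hT : ∀ t ∈ T, ∀ x ∈ t, ∃ y, y ∉ t ∧ insert y (t.erase x) ∈ T) {x a b : α}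
    (hxa : x ≠ a) (hxb : x ≠ b) (ht : {x, a, b} ∈ T) :
    ∃ c, c ≠ x ∧ c ≠ a ∧ c ≠ b ∧ {c, a, b} ∈ T := by
  obtain ⟨c, hc, h⟩ := hT _ ht x (by simp)
  rw [erase_insert (by simp [hxa, hxb])] at h
  simp only [mem_insert, mem_singleton, not_or] at hc
  exact ⟨c, hc.1, hc.2.1, hc.2.2, h⟩

lemma triple_swap (a b c : α) : ({a, b, c} : Finset α) = {b, a, c} := insert_comm _ _ _

lemma triple_swap' (a b c : α) : ({a, b, c} : Finset α) = {a, c, b} := by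
  rw [pair_comm]

/-- Every vertex of a family of triangles without boundary lies on three of its triangles. -/
lemma three_le_card_filter_mem {T : Finset (Finset α)} (h3 : ∀ t ∈ T, #t = 3)
    (hT : ∀ t ∈ T, ∀ x ∈ t, ∃ y, y ∉ t ∧ insert y (t.erase x) ∈ T) {t : Finset α}
    (ht : t ∈ T) {i : α} (hi : i ∈ t) : 3 ≤ #{s ∈ T | i ∈ s} := by
  obtain ⟨a, b, hab, h⟩ := card_eq_two.1
    (show #(t.erase i) = 2 by rw [card_erase_of_mem hi, h3 t ht])
  obtain rfl : t = {i, a, b} := by rw [← h, insert_erase hi]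
  have hia : i ≠ a := fun e => by have : a ∈ ({a, b} : Finset α) := by simp
                                  rw [← h, e] at this; simp at this
  have hib : i ≠ b := fun e => by have : b ∈ ({a, b} : Finset α) := by simp
                                  rw [← h, e] at this; simp at this
  obtain ⟨c, hca, hci, hcb, hcT⟩ := exists_flip hT hia.symm hab (triple_swap i a b ▸ ht)
  obtain ⟨d, hdb, hda, hdi, hdT⟩ := exists_flip hT hab.symm hib.symm
    (show {b, a, i} ∈ T by rwa [triple_swap', triple_swap, triple_swap'])
  have hsub : ({{i, a, b}, {c, i, b}, {d, a, i}} : Finset (Finset α)) ⊆ {s ∈ T | i ∈ s} := by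
    intro s hs
    simp only [mem_insert, mem_singleton] at hs
    rcases hs with rfl | rfl | rfl <;> simp [*]
  refine le_trans (le_of_eq ?_) (card_le_card hsub)
  symm
  rw [card_eq_three]
  refine ⟨_, _, _, ?_, ?_, ?_, rfl⟩
  · exact ne_of_mem_notMem a (by simp) (by simp [hia.symm, hab, hca.symm])
  · exact ne_of_mem_notMem b (by simp) (by simp [hib.symm, hab.symm, hdb.symm])
  · exact ne_of_mem_notMem b (by simp) (by simp [hib.symm, hab.symm, hdb.symm])

/-- If exactly three triangles of a family without boundary contain `i`, then the triangles at `i`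
across two edges of a triangle have the same apex. -/
lemma apex_eq_of_card_eq_three {T : Finset (Finset α)}
    (hT : ∀ t ∈ T, ∀ x ∈ t, ∃ y, y ∉ t ∧ insert y (t.erase x) ∈ T) {i a b c d : α}
    (hi : #{s ∈ T | i ∈ s} = 3) (hia : i ≠ a) (hib : i ≠ b) (hab : a ≠ b)
    (hci : c ≠ i) (hca : c ≠ a) (hcb : c ≠ b) (hda : d ≠ a)
    (ht : {i, a, b} ∈ T) (hc : {i, a, c} ∈ T) (hd : {i, b, d} ∈ T) : c = d := by
  by_contra hcd
  have hsub : ({{i, a, b}, {i, a, c}, {i, b, d}} : Finset (Finset α)) ⊆ {s ∈ T | i ∈ s} := by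
    intro s hs
    simp only [mem_insert, mem_singleton] at hs
    rcases hs with rfl | rfl | rfl <;> simp [*]
  have h := eq_of_subset_of_card_le hsub <| by
    rw [hi, card_eq_three.2 ⟨_, _, _, ?_, ?_, ?_, rfl⟩]
    · exact ne_of_mem_notMem b (by simp) (by simp [hib.symm, hab.symm, hcb.symm])
    · exact ne_of_mem_notMem a (by simp) (by simp [hia.symm, hab, hda.symm])
    · exact ne_of_mem_notMem a (by simp) (by simp [hia.symm, hab, hda.symm])
  obtain ⟨y, hya, hyi, hyc, hy⟩ := exists_flip hT hia.symm hca.symm (triple_swap i a c ▸ hc)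
  have hmem : {y, i, c} ∈ ({{i, a, b}, {i, a, c}, {i, b, d}} : Finset (Finset α)) := by
    rw [h]; simp [hy]
  simp only [mem_insert, mem_singleton] at hmem
  rcases hmem with h | h | h
  · exact ne_of_mem_notMem a (by simp) (by simp [hia.symm, hya.symm, hca.symm]) h.symm
  · exact ne_of_mem_notMem a (by simp) (by simp [hia.symm, hya.symm, hca.symm]) h.symm
  · exact ne_of_mem_notMem c (by simp) (by simp [hci, hcb, hcd]) h

/-- A family of triangles without boundary covering six points has at least seven members. -/
lemma seven_le_card {T : Finset (Finset α)} (h3 : ∀ t ∈ T, #t = 3)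
    (hT : ∀ t ∈ T, ∀ x ∈ t, ∃ y, y ∉ t ∧ insert y (t.erase x) ∈ T) {W : Finset α}
    (hW : #W = 6) (hTW : ∀ t ∈ T, t ⊆ W) (hcov : ∀ i ∈ W, ∃ t ∈ T, i ∈ t) : 7 ≤ #T := by
  by_contra! hlt
  have hdeg : ∀ i ∈ W, 3 ≤ #{s ∈ T | i ∈ s} := fun i hi => by
    obtain ⟨t, ht, hit⟩ := hcov i hi
    exact three_le_card_filter_mem h3 hT ht hit
  have hsum : ∑ i ∈ W, #{s ∈ T | i ∈ s} = ∑ s ∈ T, 3 := by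
    rw [← sum_congr rfl h3]
    refine (sum_card_bipartiteAbove_eq_sum_card_bipartiteBelow (fun i s => i ∈ s)).trans
      (sum_congr rfl fun s hs => ?_)
    rw [bipartiteBelow, filter_mem_eq_inter, inter_eq_right.2 (hTW s hs)]
  have heq : ∀ i ∈ W, #{s ∈ T | i ∈ s} = 3 := by
    have hle : ∑ i ∈ W, #{s ∈ T | i ∈ s} ≤ ∑ i ∈ W, 3 := by
      rw [hsum]; simp only [sum_const, smul_eq_mul]; omega
    intro i hi
    exact ((sum_eq_sum_iff_of_le hdeg).1 (le_antisymm (sum_le_sum hdeg) hle) i hi).symm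
  obtain ⟨w, hw⟩ : W.Nonempty := card_pos.1 (by omega)
  obtain ⟨t, ht, -⟩ := hcov w hw
  obtain ⟨i, a, b, hia, hib, hab, rfl⟩ := card_eq_three.1 (h3 t ht)
  have hiW : i ∈ W := hTW _ ht (by simp)
  have haW : a ∈ W := hTW _ ht (by simp)
  have ht' : {a, i, b} ∈ T := triple_swap i a b ▸ ht
  have ht'' : {b, i, a} ∈ T := by rwa [triple_swap, triple_swap']
  obtain ⟨c, hcb, hci, hca, hcT⟩ := exists_flip hT hib.symm hab.symm ht''
  obtain ⟨d, hda, hdi, hdb, hdT⟩ := exists_flip hT hia.symm hab ht'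
  obtain ⟨x, hxi, hxa, hxb, hxT⟩ := exists_flip hT hia hib ht
  replace hcT : {i, a, c} ∈ T := by rwa [triple_swap', triple_swap]
  replace hdT : {i, b, d} ∈ T := by rwa [triple_swap', triple_swap]
  replace hxT : {a, b, x} ∈ T := by rwa [triple_swap', triple_swap]
  obtain rfl : c = d := apex_eq_of_card_eq_three hT (heq i hiW) hia hib hab hci hca hcb hda
    ht hcT hdT
  obtain rfl : c = x := apex_eq_of_card_eq_three hT (heq a haW) hia.symm hab hib hca hci hcb hxi
    ht' (triple_swap i a c ▸ hcT) hxT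
  obtain ⟨y, hyW, hy⟩ : ∃ y ∈ W, y ∉ ({i, a, b, c} : Finset α) := by
    by_contra! h
    have := card_le_card (show W ⊆ {i, a, b, c} from h)
    have := card_le_four (a := i) (b := a) (c := b) (d := c)
    omega
  simp only [mem_insert, mem_singleton, not_or] at hy
  have hfour : ({{i, a, b}, {i, a, c}, {i, b, c}, {a, b, c}} : Finset (Finset α)) ⊆
      {s ∈ T | y ∉ s} := by
    intro s hs
    simp only [mem_insert, mem_singleton] at hs
    rcases hs with rfl | rfl | rfl | rfl <;> simp [*]
  have hc4 : #({{i, a, b}, {i, a, c}, {i, b, c}, {a, b, c}} : Finset (Finset α)) = 4 := by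
    rw [card_insert_of_notMem, card_insert_of_notMem, card_insert_of_notMem, card_singleton]
    · simp only [mem_singleton]
      exact ne_of_mem_notMem i (by simp) (by simp [hia, hib, hci.symm])
    · simp only [mem_insert, mem_singleton, not_or]
      exact ⟨ne_of_mem_notMem a (by simp) (by simp [hia.symm, hab, hca.symm]),
        ne_of_mem_notMem i (by simp) (by simp [hia, hib, hci.symm])⟩
    · simp only [mem_insert, mem_singleton, not_or]
      exact ⟨ne_of_mem_notMem b (by simp) (by simp [hib.symm, hab.symm, hcb.symm]),
        ne_of_mem_notMem a (by simp) (by simp [hia.symm, hab, hca.symm]),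
        ne_of_mem_notMem i (by simp) (by simp [hia, hib, hci.symm])⟩
  have := card_le_card hfour
  have := heq y hyW
  have := card_filter_add_card_filter_not (s := T) (fun s => y ∈ s)
  omega

lemma subset_verts {K : Complex α} {σ : Finset α} (h : σ ∈ K) : σ ⊆ verts K :=
  le_sup (f := id) h

lemma mem_verts_link {K : Complex α} (hK : IsComplex K) {x y : α} :
    y ∈ verts (link K {x}) ↔ y ≠ x ∧ {x, y} ∈ K := by
  simp only [verts, mem_sup, link, mem_filter, id, disjoint_singleton_right]
  constructor
  · rintro ⟨τ, ⟨-, hx, hxτ⟩, hy⟩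
    refine ⟨fun h => hx (h ▸ hy), hK.2.2 _ hxτ _ ?_ (by simp)⟩
    rw [insert_subset_iff, singleton_subset_iff]
    simp [hy]
  · rintro ⟨hyx, h⟩
    exact ⟨{y}, ⟨hK.2.2 _ h _ (by simp) (by simp), by simpa using hyx.symm, h⟩, by simp⟩

/-- A ridge of a weak pseudomanifold is completed to a facet by exactly two vertices. -/
lemma WeakPM.card_completions {K : Complex α} {d : ℕ} (hK : WeakPM K d) {t : Finset α}
    (ht : t ∈ K) (hc : #t = d) : #{w ∈ verts K \ t | insert w t ∈ K} = 2 := by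
  rw [← hK.2.2 t ht hc]
  refine card_bij (fun w _ => insert w t) ?_ ?_ ?_
  · intro w hw
    simp only [mem_filter, mem_sdiff] at hw ⊢
    exact ⟨hw.2, subset_insert _ _, by rw [card_insert_of_notMem hw.1.2, hc]⟩
  · intro w hw w' hw' h
    simp only [mem_filter, mem_sdiff] at hw hw'
    exact insert_inj hw.1.2 |>.1 h
  · intro τ hτ
    simp only [mem_filter] at hτ
    obtain ⟨w, hw⟩ := card_eq_one.1
      (show #(τ \ t) = 1 by rw [card_sdiff_of_subset hτ.2.1, hτ.2.2, hc]; omega)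
    have hwτ : w ∈ τ \ t := by rw [hw]; simp
    rw [mem_sdiff] at hwτ
    have hins : insert w t = τ := by
      rw [insert_eq, ← hw, sdiff_union_of_subset hτ.2.1]
    exact ⟨w, by simp [hins, hτ.1, hwτ.2, subset_verts hτ.1 hwτ.1], hins⟩

/-- In a weak `3`-pseudomanifold, a vertex of degree `6` lies on at least seven facets. -/
lemma WeakPM.seven_le_card_facets {K : Complex α} (hK : WeakPM K 3) {W : Finset α} (hW : #W = 6)
    {x : α} (hx : ∀ y, y ∈ W ↔ y ≠ x ∧ {x, y} ∈ K) :
    7 ≤ #{t ∈ powersetCard 3 W | insert x t ∈ K} := by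
  have hxW : x ∉ W := fun h => ((hx x).1 h).1 rfl
  have hsub : ∀ t, x ∉ t → insert x t ∈ K → t ⊆ W := fun t hxt h y hy => by
    refine (hx y).2 ⟨fun e => hxt (e ▸ hy), hK.1.2.2 _ h _ ?_ (by simp)⟩
    rw [insert_subset_iff, singleton_subset_iff]
    simp [hy]
  refine seven_le_card (W := W) ?_ ?_ hW ?_ ?_
  · intro t ht
    exact (mem_powersetCard.1 (mem_filter.1 ht).1).2
  · intro t ht z hz
    simp only [mem_filter, mem_powersetCard] at ht
    obtain ⟨⟨htW, htc⟩, htK⟩ := ht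
    have hxt : x ∉ t := fun h => hxW (htW h)
    have hzx : z ≠ x := fun h => hxt (h ▸ hz)
    have hxe : x ∉ t.erase z := fun h => hxt (mem_of_mem_erase h)
    have hc : #(insert x (t.erase z)) = 3 := by
      rw [card_insert_of_notMem hxe, card_erase_of_mem hz, htc]
    have hr : insert x (t.erase z) ∈ K :=
      hK.1.2.2 _ htK _ (insert_subset_insert _ (erase_subset _ _)) (by simp)
    have h2 := hK.card_completions hr hc
    obtain ⟨y, hy, hyz⟩ := exists_mem_ne
      (show 1 < #{w ∈ verts K \ insert x (t.erase z) | insert w (insert x (t.erase z)) ∈ K} by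
        omega) z
    simp only [mem_filter, mem_sdiff, mem_insert, not_or, mem_erase] at hy
    obtain ⟨⟨-, hyx, hye⟩, hyK⟩ := hy
    have hyt : y ∉ t := fun h => hye ⟨hyz, h⟩
    rw [insert_comm] at hyK
    refine ⟨y, hyt, ?_⟩
    rw [mem_filter, mem_powersetCard]
    refine ⟨⟨hsub _ ?_ hyK, ?_⟩, hyK⟩
    · simp [Ne.symm hyx, hxt]
    · rw [card_insert_of_notMem (fun h => hyt (mem_of_mem_erase h)), card_erase_of_mem hz, htc]
  · intro t ht
    exact (mem_powersetCard.1 (mem_filter.1 ht).1).1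
  · intro i hi
    obtain ⟨hix, h⟩ := (hx i).1 hi
    obtain ⟨σ, hσ, hs, hc⟩ := hK.2.1 _ h
    have hxσ : x ∈ σ := hs (by simp)
    have hiσ : i ∈ σ := hs (by simp)
    have hins : insert x (σ.erase x) ∈ K := by rwa [insert_erase hxσ]
    refine ⟨σ.erase x, ?_, by simp [hix, hiσ]⟩
    rw [mem_filter, mem_powersetCard]
    exact ⟨⟨hsub _ (by simp) hins, by rw [card_erase_of_mem hxσ, hc]⟩, hins⟩

/-- In an eight-vertex weak `3`-pseudomanifold, the links of two non-adjacent vertices of degree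
`6` share a triangle. -/
lemma WeakPM.exists_common_triangle {K : Complex α} (hK : WeakPM K 3) {W : Finset α} (hW : #W = 6)
    {u v : α} (huv : u ≠ v) (hV : verts K = insert u (insert v W))
    (hu : ∀ y, y ∈ W ↔ y ≠ u ∧ {u, y} ∈ K) (hv : ∀ y, y ∈ W ↔ y ≠ v ∧ {v, y} ∈ K) :
    ∃ t ⊆ W, #t = 3 ∧ insert u t ∈ K ∧ insert v t ∈ K := by
  by_contra! hno
  have huW : u ∉ W := fun h => ((hu u).1 h).1 rfl
  have hvW : v ∉ W := fun h => ((hv v).1 h).1 rfl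
  have h7u := hK.seven_le_card_facets hW hu
  have h7v := hK.seven_le_card_facets hW hv
  let s : Finset α → ℤ := fun t => ∑ w ∈ W \ t, if insert w t ∈ K then 1 else 0
  have hs : ∀ t ∈ powersetCard 3 W, ((if insert u t ∈ K then 1 else 0) +
      (if insert v t ∈ K then 1 else 0) : ℤ) = s t * (2 - s t) := by
    intro t ht
    obtain ⟨htW, htc⟩ := mem_powersetCard.1 ht
    by_cases htK : t ∈ K
    · have h2 := hK.card_completions htK htc
      have hut : u ∉ t := fun h => huW (htW h)
      have hvt : v ∉ t := fun h => hvW (htW h)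
      rw [card_filter, hV, insert_sdiff_of_notMem _ hut, insert_sdiff_of_notMem _ hvt,
        sum_insert (by simp [huv, huW]), sum_insert (by simp [hvW])] at h2
      have h2' : ((if insert u t ∈ K then 1 else 0) + ((if insert v t ∈ K then 1 else 0) + s t) : ℤ)
          = 2 := by simp only [s]; exact_mod_cast congrArg (Nat.cast : ℕ → ℤ) h2
      have := hno t htW htc
      split_ifs at h2' ⊢ with h₁ h₂ h₂
      · exact absurd h₂ (this h₁)
      · rw [show s t = 1 by linarith]; norm_num
      · rw [show s t = 1 by linarith]; norm_num
      · rw [show s t = 2 by linarith]; norm_num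
    · have hn : ∀ w, insert w t ∉ K := fun w h =>
        htK (hK.1.2.2 _ h _ (subset_insert _ _) (card_pos.1 (by omega)))
      simp [s, hn]
  have hsum : (14 : ℤ) ≤ ∑ t ∈ powersetCard 3 W, s t * (2 - s t) := by
    rw [← sum_congr rfl hs, sum_add_distrib, sum_boole, sum_boole]
    exact_mod_cast (by omega : 14 ≤ #{t ∈ powersetCard 3 W | insert u t ∈ K} +
      #{t ∈ powersetCard 3 W | insert v t ∈ K})
  let e : Fin 6 ↪ α := (W.equivFinOfCardEq hW).symm.toEmbedding.trans (Function.Embedding.subtype _)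
  have he : univ.map e = W := by
    ext y
    simp only [mem_map, mem_univ, true_and]
    constructor
    · rintro ⟨i, rfl⟩
      exact ((W.equivFinOfCardEq hW).symm i).2
    · intro hy
      exact ⟨W.equivFinOfCardEq hW ⟨y, hy⟩, by simp [e]⟩
  have h12 := sum_triples_le_twelve (fun q => if q.map e ∈ K then 1 else 0)
    (fun q => by by_cases h : q.map e ∈ K <;> simp [h])
  rw [← he, powersetCard_map, sum_map] at hsum
  have hst : ∀ t : Finset (Fin 6), s (t.map e) =
      ∑ i ∈ tᶜ, if (insert i t).map e ∈ K then 1 else 0 := by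
    intro t
    simp only [s]
    rw [← he, ← Finset.map_sdiff, sum_map, ← compl_eq_univ_sdiff]
    simp only [map_insert]
  simp only [mapEmbedding_apply, RelEmbedding.coe_toEmbedding, hst] at hsum
  linarith

lemma mem_genCx {F : Finset (Finset α)} {τ : Finset α} :
    τ ∈ genCx F ↔ τ.Nonempty ∧ ∃ σ ∈ F, τ ⊆ σ := by
  simp only [genCx, mem_biUnion, mem_filter, mem_powerset]
  tauto

lemma isComplex_genCx {F : Finset (Finset α)} (hF : ∃ σ ∈ F, σ.Nonempty) :
    IsComplex (genCx F) := by
  obtain ⟨σ, hσ, hne⟩ := hF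
  refine ⟨⟨σ, mem_genCx.2 ⟨hne, σ, hσ, Subset.rfl⟩⟩, fun τ hτ => (mem_genCx.1 hτ).1,
    fun τ hτ ρ hρ hρne => ?_⟩
  obtain ⟨-, σ', hσ', h⟩ := mem_genCx.1 hτ
  exact mem_genCx.2 ⟨hρne, σ', hσ', hρ.trans h⟩

/-- The link of a triangle completed by exactly the vertices `u` and `v`. -/
lemma WeakPM.link_eq_stdSphere {K : Complex α} (hK : WeakPM K 3) {t : Finset α} (htc : #t = 3)
    {u v : α} (huv : u ≠ v) (hut : u ∉ t) (hvt : v ∉ t) (hu : insert u t ∈ K)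
    (hv : insert v t ∈ K) : link K t = stdSphere {u, v} := by
  have htK : t ∈ K := hK.1.2.2 _ hu _ (subset_insert _ _) (card_pos.1 (by omega))
  have hcomp : ({u, v} : Finset α) = {w ∈ verts K \ t | insert w t ∈ K} := by
    refine eq_of_subset_of_card_le ?_ (by rw [hK.card_completions htK htc, card_pair huv])
    intro w hw
    simp only [mem_insert, mem_singleton] at hw
    rcases hw with rfl | rfl
    · simp [hu, hut, subset_verts hu (mem_insert_self _ _)]
    · simp [hv, hvt, subset_verts hv (mem_insert_self _ _)]
  ext τ
  simp only [link, stdSphere, mem_filter, mem_powerset]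
  constructor
  · rintro ⟨hτ, hd, hτt⟩
    have hne := hK.1.2.1 _ hτ
    have hc := card_le_of_isPure hK.2.1 hτt
    rw [card_union_of_disjoint hd.symm, htc] at hc
    have hpos := hne.card_pos
    obtain ⟨w, rfl⟩ := card_eq_one.1 (show #τ = 1 by omega)
    refine ⟨?_, hne, ?_⟩
    · rw [singleton_subset_iff, hcomp]
      simp only [mem_filter, mem_sdiff]
      exact ⟨⟨subset_verts hτ (by simp), by simpa using hd⟩, by rwa [insert_eq, union_comm]⟩
    · intro h
      have := congrArg Finset.card h
      rw [card_pair huv, card_singleton] at this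
      omega
  · rintro ⟨hsub, hne, hneq⟩
    have hlt := card_lt_card (hsub.ssubset_of_ne hneq)
    rw [card_pair huv] at hlt
    have hpos := hne.card_pos
    obtain ⟨w, rfl⟩ := card_eq_one.1 (show #τ = 1 by omega)
    rw [singleton_subset_iff, hcomp] at hsub
    simp only [mem_filter, mem_sdiff] at hsub
    refine ⟨hK.1.2.2 _ hsub.2 _ (by simp) (by simp), by simpa using hsub.1.2, ?_⟩
    rw [union_comm, ← insert_eq]
    exact hsub.2

end NPM

open Finset NPM in
/-- in a non-neighbourly 8-vertex 3-pseudomanifold all of whose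
vertices have degree at least 6, a vertex of degree 6 can be given degree 7
by a single bistellar 1-move. -/
theorem statement16 {α : Type u} [DecidableEq α] (M : NPM.Complex α)
    (hM : NPM.IsPM M 3) (h8 : (NPM.verts M).card = 8)
    (hnn : ¬ NPM.Neighbourly M)
    (hmin : ∀ v ∈ NPM.verts M, 6 ≤ NPM.degree M {v})
    (u : α) (hu : u ∈ NPM.verts M) (hd : NPM.degree M {u} = 6) :
    ∃ N : NPM.Complex α, NPM.BMove 3 1 M N ∧ NPM.degree N {u} = 7 := by
  have hK : WeakPM M 3 := hM.1
  have hlink : ∀ x, verts (link M {x}) ⊆ (verts M).erase x := fun x y hy => by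
    rw [mem_verts_link hK.1] at hy
    exact mem_erase.2 ⟨hy.1, subset_verts hy.2 (by simp)⟩
  obtain ⟨W, hWdef⟩ : ∃ W, W = verts (link M {u}) := ⟨_, rfl⟩
  have hW : #W = 6 := hWdef ▸ hd
  have huW : ∀ y, y ∈ W ↔ y ≠ u ∧ {u, y} ∈ M := fun y => by rw [hWdef, mem_verts_link hK.1]
  have hWsub : W ⊆ (verts M).erase u := hWdef ▸ hlink u
  obtain ⟨v, hv⟩ := card_eq_one.1 (show #((verts M).erase u \ W) = 1 by
    rw [card_sdiff_of_subset hWsub, card_erase_of_mem hu, h8, hW])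
  have hvmem : v ∈ (verts M).erase u \ W := by rw [hv]; simp
  simp only [mem_sdiff, mem_erase] at hvmem
  obtain ⟨⟨hvu, hvM⟩, hvW⟩ := hvmem
  have hV' : (verts M).erase u = insert v W := by
    rw [insert_eq, ← hv, sdiff_union_of_subset hWsub]
  have hV : verts M = insert u (insert v W) := by rw [← hV', insert_erase hu]
  have huv : {u, v} ∉ M := fun h => hvW ((huW v).2 ⟨hvu, h⟩)
  have hlv : verts (link M {v}) = W := by
    refine eq_of_subset_of_card_le (fun y hy => ?_) (hW ▸ hmin v hvM)
    have hy' := mem_erase.1 (hlink v hy)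
    rw [hV, mem_insert, mem_insert] at hy'
    rw [mem_verts_link hK.1] at hy
    rcases hy'.2 with rfl | h | h
    · exact absurd (pair_comm v y ▸ hy.2) huv
    · exact absurd h hy.1
    · exact h
  have hvW' : ∀ y, y ∈ W ↔ y ≠ v ∧ {v, y} ∈ M := fun y => by rw [← hlv, mem_verts_link hK.1]
  obtain ⟨t, htW, htc, htu, htv⟩ := hK.exists_common_triangle hW hvu.symm hV huW hvW'
  have hut : u ∉ t := fun h => ((huW u).1 (htW h)).1 rfl
  have hvt : v ∉ t := fun h => hvW (htW h)
  have htM : t ∈ M := hK.1.2.2 _ htu _ (subset_insert _ _) (card_pos.1 (by omega))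
  obtain ⟨F, hF⟩ : ∃ F, F = (facets M 3).filter (fun σ => ¬ t ⊆ σ) ∪
      t.image fun x => (({u, v} : Finset α) ∪ t).erase x := ⟨_, rfl⟩
  have hnew : ∀ x ∈ t, (({u, v} : Finset α) ∪ t).erase x ∈ F := fun x hx => by
    rw [hF]; exact mem_union_right _ (mem_image_of_mem _ hx)
  refine ⟨genCx F, ⟨t, {u, v}, htM, htc, card_pair hvu.symm, huv,
    hK.link_eq_stdSphere htc hvu.symm hut hvt htu htv, by rw [hF]⟩, ?_⟩
  obtain ⟨x, hx⟩ : t.Nonempty := card_pos.1 (by omega)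
  have hux : u ≠ x := fun h => hut (h ▸ hx)
  have hvx : v ≠ x := fun h => hvt (h ▸ hx)
  have hgen : IsComplex (genCx F) := isComplex_genCx ⟨_, hnew x hx, u, by simp [hux]⟩
  have hpair : ∀ y, {u, y} ∈ genCx F ↔ ∃ σ ∈ F, u ∈ σ ∧ y ∈ σ := fun y => by
    simp [mem_genCx, insert_subset_iff]
  suffices h : verts (link (genCx F) {u}) = (verts M).erase u by
    rw [degree, h, card_erase_of_mem hu, h8]
  ext y
  rw [mem_verts_link hgen, mem_erase, hpair]
  refine and_congr_right fun hyu => ⟨?_, fun hy => ?_⟩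
  · rintro ⟨σ, hσ, -, hyσ⟩
    rw [hF, mem_union, mem_filter, facets, mem_filter, mem_image] at hσ
    rcases hσ with hσ | ⟨z, -, rfl⟩
    · exact subset_verts hσ.1.1 hyσ
    · have := mem_of_mem_erase hyσ
      simp only [mem_union, mem_insert, mem_singleton] at this
      rcases this with (rfl | rfl) | h
      · exact hu
      · exact hvM
      · exact subset_verts htM h
  · by_cases hyt : y ∈ t
    · obtain ⟨z, hz, hzy⟩ := exists_mem_ne (s := t) (by omega) y
      exact ⟨_, hnew z hz, by simp [show u ≠ z from fun h => hut (h ▸ hz)], by simp [hzy.symm, hyt]⟩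
    · by_cases hyv : y = v
      · subst hyv
        exact ⟨_, hnew x hx, by simp [hux], by simp [hvx]⟩
      · have hyW : y ∈ W := by
          rw [hV, mem_insert, mem_insert] at hy
          tauto
        obtain ⟨σ, hσ, hs, hc⟩ := hK.2.1 _ ((huW y).1 hyW).2
        have huσ : u ∈ σ := hs (by simp)
        have hyσ : y ∈ σ := hs (by simp)
        refine ⟨σ, ?_, huσ, hyσ⟩
        rw [hF]
        refine mem_union_left _ (mem_filter.2 ⟨mem_filter.2 ⟨hσ, hc⟩, fun htσ => ?_⟩)
        have hle := card_le_card (show insert y (insert u t) ⊆ σ from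
          insert_subset hyσ (insert_subset huσ htσ))
        rw [card_insert_of_notMem (by simp [hyu, hyt]), card_insert_of_notMem hut] at hle
        omega
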